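/- For every integer M ≥ 0 and every real number x with |x| ≤ π/(8M+1), one has Σ_{k=−4M}^{4M} cos(kx) ≥ (2/π)(8M+1). -/

import Mathlib

open Real

/-- The closed form of the Dirichlet kernel, multiplied through by `sin (x / 2)`. -/
theorem sin_half_mul_sum_Icc_cos (n : ℕ) (x : ℝ) :
    sin (x / 2) * ∑ k ∈ Finset.Icc (-(n : ℤ)) n, cos (k * x) = sin ((2 * n + 1) * (x / 2)) := by
  induction n with
  | zero => simp
  | succ n ih =>
    have hIcc : Finset.Icc (-((n + 1 : ℕ) : ℤ)) ((n + 1 : ℕ) : ℤ) =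
        insert ((n : ℤ) + 1) (insert (-((n : ℤ) + 1)) (Finset.Icc (-(n : ℤ)) n)) := by
      ext k
      simp only [Finset.mem_Icc, Finset.mem_insert]
      omega
    rw [hIcc, Finset.sum_insert (by simp only [Finset.mem_Icc, Finset.mem_insert]; omega),
      Finset.sum_insert (by simp only [Finset.mem_Icc]; omega), mul_add, mul_add, ih]
    push_cast
    have hneg : cos (-((n : ℝ) + 1) * x) = cos (((n : ℝ) + 1) * x) := by
      rw [neg_mul, cos_neg]
    have hsucc : (2 * ((n : ℝ) + 1) + 1) * (x / 2) = (n + 1) * x + x / 2 := by ring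
    have hself : (2 * (n : ℝ) + 1) * (x / 2) = (n + 1) * x - x / 2 := by ring
    rw [hneg, hsucc, hself, sin_add, sin_sub]
    ring

/-- For every integer `M ≥ 0` and every real `x` with `|x| ≤ π/(8M+1)`,
the Dirichlet kernel sum satisfies `Σ_{k=−4M}^{4M} cos(kx) ≥ (2/π)(8M+1)`. -/
theorem statement9 (M : ℕ) (x : ℝ) (hx : |x| ≤ π / (8 * M + 1)) :
    2 / π * (8 * M + 1) ≤ ∑ k ∈ Finset.Icc (-(4 * M : ℤ)) (4 * M : ℤ), Real.cos (k * x) := by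
  have hN : (1 : ℝ) ≤ 8 * M + 1 := by linarith [M.cast_nonneg (α := ℝ)]
  have habs : ∀ k : ℤ, cos (k * x) = cos (k * |x|) := fun k => by
    rw [← cos_abs (k * x), ← cos_abs (k * |x|), abs_mul, abs_mul, abs_abs]
  simp only [habs]
  have hy := abs_nonneg x
  generalize |x| = y at hx hy
  rw [le_div_iff₀ (by linarith)] at hx
  rcases hy.eq_or_lt with rfl | hy
  · have hcard : (((4 * M + 1 + 4 * M : ℤ).toNat : ℕ) : ℝ) = 8 * M + 1 := by
      rw [show (4 * M + 1 + 4 * M : ℤ).toNat = 8 * M + 1 by omega]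
      push_cast
      rfl
    have hpi : 2 / π ≤ 1 := (div_le_one pi_pos).2 two_le_pi
    simp only [mul_zero, cos_zero, Finset.sum_const, Int.card_Icc, sub_neg_eq_add, nsmul_eq_mul,
      mul_one, hcard]
    exact mul_le_of_le_one_left (by linarith) hpi
  · have hkernel := sin_half_mul_sum_Icc_cos (4 * M) y
    push_cast at hkernel
    have hsin_pos : 0 < sin (y / 2) := sin_pos_of_pos_of_lt_pi (by linarith) (by nlinarith)
    have hsin_le : sin (y / 2) ≤ y / 2 := sin_le (by linarith)
    have hjordan : 2 / π * ((2 * (4 * M) + 1) * (y / 2)) ≤ sin ((2 * (4 * M) + 1) * (y / 2)) :=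
      mul_le_sin (by positivity) (by linarith)
    have hC : 0 ≤ 2 / π * (8 * M + 1) := by positivity
    refine le_of_mul_le_mul_left ?_ hsin_pos
    rw [hkernel]
    calc sin (y / 2) * (2 / π * (8 * M + 1)) ≤ y / 2 * (2 / π * (8 * M + 1)) :=
          mul_le_mul_of_nonneg_right hsin_le hC
      _ = 2 / π * ((2 * (4 * M) + 1) * (y / 2)) := by ring
      _ ≤ _ := hjordan
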